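/- For any n ∈ O_FS, the cyclic group ℤ/nℤ is FS-regular: for any two finite multisets A, A' with elements in ℤ/nℤ, FS(A) = FS(A') if and only if A ∼₀ A'. -/

import Mathlib

/-- The subset sums multiset: the multiset of sums of all sub-multisets of `A`. -/
def FS {G : Type*} [AddCommGroup G] (A : Multiset G) : Multiset G :=
  A.powerset.map Multiset.sum

/-- `A ∼₀ A'`: `A'` is obtained from `A` by flipping the signs of a zero-sum sub-multiset. -/
def Sim0 {G : Type*} [AddCommGroup G] [DecidableEq G] (A A' : Multiset G) : Prop :=
  ∃ B ≤ A, B.sum = 0 ∧ A' = (A - B) + B.map (fun x => -x)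

/-- `O_FS` : odd naturals `n ≥ 1` such that `(ℤ/nℤ)*` is covered by `{±2^j : j ≥ 0}`. -/
def OFS (n : ℕ) : Prop :=
  Odd n ∧ 1 ≤ n ∧ ∀ x : ℤ, IsCoprime x (n : ℤ) →
    ∃ j : ℕ, (n : ℤ) ∣ x - 2 ^ j ∨ (n : ℤ) ∣ x + 2 ^ j

open Filter Topology in
theorem sbp (c w : ℕ → ℂ) (N : ℕ) : ∑ m ∈ Finset.range N, c m * w m =
    (∑ i ∈ Finset.range N, c i) * w N +
      ∑ m ∈ Finset.range N, (∑ i ∈ Finset.range (m+1), c i) * (w m - w (m+1)) := by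
  induction N with
  | zero => simp
  | succ N ih =>
    rw [Finset.sum_range_succ, ih,
      Finset.sum_range_succ (fun m => (∑ i ∈ Finset.range (m+1), c i) * (w m - w (m+1))) N,
      Finset.sum_range_succ c N]
    ring

theorem summable_inv_sq (M K : ℝ) : Summable (fun m : ℕ => M * (K / ((m:ℝ)+1)^2)) := by
  have h := (summable_nat_add_iff (f := fun m : ℕ => 1 / ((m:ℝ))^2) 1).2
    (Real.summable_one_div_nat_pow.2 (by norm_num))
  refine ((h.mul_left K).mul_left M).congr ?_
  intro m
  push_cast
  ring

open Filter Topology in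
theorem tendsto_weights (c : ℕ → ℂ) (M K : ℝ)
    (hM : ∀ N, ‖∑ i ∈ Finset.range N, c i‖ ≤ M)
    (l : Filter ℝ) [l.IsCountablyGenerated] (w : ℝ → ℕ → ℂ) (w0 : ℕ → ℂ)
    (hw : ∀ m, Tendsto (fun t => w t m) l (𝓝 (w0 m)))
    (hd : ∀ᶠ t in l, ∀ m : ℕ, ‖w t m - w t (m+1)‖ ≤ K / ((m:ℝ)+1)^2)
    (hs : ∀ᶠ t in l, Summable (fun m => c m * w t m))
    (hz : ∀ᶠ t in l, Tendsto (w t) atTop (𝓝 0)) :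
    Tendsto (fun t => ∑' m, c m * w t m) l
      (𝓝 (∑' m, (∑ i ∈ Finset.range (m+1), c i) * (w0 m - w0 (m+1)))) := by
  have key : ∀ᶠ t in l, ∑' m, (∑ i ∈ Finset.range (m+1), c i) * (w t m - w t (m+1))
      = ∑' m, c m * w t m := by
    filter_upwards [hd, hs, hz] with t hd hs hz
    have hsum : Summable (fun m => (∑ i ∈ Finset.range (m+1), c i) * (w t m - w t (m+1))) := by
      refine Summable.of_norm_bounded (summable_inv_sq M K) ?_
      intro m
      rw [norm_mul]
      exact mul_le_mul (hM _) (hd m) (norm_nonneg _) ((norm_nonneg _).trans (hM 0))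
    have h1 := hs.hasSum.tendsto_sum_nat
    have h2 := hsum.hasSum.tendsto_sum_nat
    have h3 : Tendsto (fun N => (∑ i ∈ Finset.range N, c i) * w t N) atTop (𝓝 0) := by
      have : Tendsto (fun N => M * ‖w t N‖) atTop (𝓝 0) := by
        simpa using (hz.norm.const_mul M)
      refine squeeze_zero_norm ?_ this
      intro N
      rw [norm_mul]
      exact mul_le_mul_of_nonneg_right (hM N) (norm_nonneg _)
    have h4 := h3.add h2
    rw [zero_add] at h4
    refine tendsto_nhds_unique h4 (h1.congr ?_)
    intro N
    exact sbp c (w t) N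
  refine Tendsto.congr' key ?_
  refine tendsto_tsum_of_dominated_convergence (summable_inv_sq M K) ?_ ?_
  · intro m
    exact ((hw m).sub (hw (m+1))).const_mul _
  · filter_upwards [hd] with t hd m
    rw [norm_mul]
    exact mul_le_mul (hM _) (hd m) (norm_nonneg _) ((norm_nonneg _).trans (hM 0))

/-- signed coefficient sequence -/
noncomputable def cf {n : ℕ} (h : ZMod n → ℂ) (m : ℕ) : ℂ := (-1)^m * h ((m+1 : ℕ) : ZMod n)

/-- regularised alternating sum of `h m / m`. -/
noncomputable def Lam {n : ℕ} (h : ZMod n → ℂ) : ℂ :=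
  ∑' m : ℕ, (∑ i ∈ Finset.range (m+1), cf h i) *
    ((((1:ℝ)/((m:ℝ)+1) : ℝ) : ℂ) - (((1:ℝ)/(((m+1:ℕ):ℝ)+1) : ℝ) : ℂ))

theorem cf_anti {n : ℕ} (hn : Odd n) (h : ZMod n → ℂ) (m : ℕ) : cf h (m + n) = - cf h m := by
  unfold cf
  rw [pow_add, hn.neg_one_pow]
  push_cast
  simp

theorem cf_bdd {n : ℕ} (hn : Odd n) (h : ZMod n → ℂ) :
    ∃ M, ∀ N, ‖∑ i ∈ Finset.range N, cf h i‖ ≤ M := by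
  have h1 : ∀ N, ∑ i ∈ Finset.range (N + n), cf h i =
      ∑ i ∈ Finset.range n, cf h i - ∑ i ∈ Finset.range N, cf h i := by
    intro N
    rw [add_comm N n, Finset.sum_range_add, sub_eq_add_neg, ← Finset.sum_neg_distrib]
    congr 1
    refine Finset.sum_congr rfl fun i _ => ?_
    rw [add_comm n i, cf_anti hn]
  have h2 : ∀ N, ∑ i ∈ Finset.range (N + 2 * n), cf h i = ∑ i ∈ Finset.range N, cf h i := by
    intro N
    rw [two_mul, ← add_assoc, h1, h1]
    ring
  have hpos : 0 < 2 * n := by have := hn.pos; omega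
  refine ⟨∑ j ∈ Finset.range (2*n), ‖∑ i ∈ Finset.range j, cf h i‖, fun N => ?_⟩
  have h3 : ∀ N, ∑ i ∈ Finset.range N, cf h i = ∑ i ∈ Finset.range (N % (2*n)), cf h i := by
    intro N
    have hp : Function.Periodic (fun N => ∑ i ∈ Finset.range N, cf h i) (2*n) := h2
    exact (hp.map_mod_nat N).symm
  rw [h3]
  exact Finset.single_le_sum (f := fun j => ‖∑ i ∈ Finset.range j, cf h i‖)
    (fun _ _ => norm_nonneg _) (Finset.mem_range.2 (Nat.mod_lt _ hpos))

theorem cf_bdd' {n : ℕ} [NeZero n] (h : ZMod n → ℂ) :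
    ∃ M, ∀ i, ‖cf h i‖ ≤ M := by
  refine ⟨∑ x, ‖h x‖, fun i => ?_⟩
  simp only [cf, norm_mul, norm_pow, norm_neg, norm_one, one_pow, one_mul]
  exact Finset.single_le_sum (f := fun j => ‖h j‖)
    (fun _ _ => norm_nonneg _) (Finset.mem_univ _)

theorem Lam_diff (m : ℕ) : ‖((((1:ℝ)/((m:ℝ)+1) : ℝ) : ℂ) - (((1:ℝ)/(((m+1:ℕ):ℝ)+1) : ℝ) : ℂ))‖
    ≤ 1 / ((m:ℝ)+1)^2 := by
  rw [← Complex.ofReal_sub, Complex.norm_real, Real.norm_eq_abs]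
  push_cast
  have : 1/((m:ℝ)+1) - 1/((m:ℝ)+1+1) = 1/(((m:ℝ)+1)*((m:ℝ)+2)) := by
    field_simp
    ring
  rw [this, abs_of_nonneg (by positivity)]
  apply one_div_le_one_div_of_le (by positivity)
  nlinarith [(Nat.cast_nonneg m : (0:ℝ) ≤ m)]

theorem Lam_summable {n : ℕ} (hn : Odd n) (h : ZMod n → ℂ) :
    Summable (fun m : ℕ => (∑ i ∈ Finset.range (m+1), cf h i) *
    ((((1:ℝ)/((m:ℝ)+1) : ℝ) : ℂ) - (((1:ℝ)/(((m+1:ℕ):ℝ)+1) : ℝ) : ℂ))) := by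
  obtain ⟨M, hM⟩ := cf_bdd hn h
  refine Summable.of_norm_bounded (summable_inv_sq M 1) ?_
  intro m
  rw [norm_mul]
  exact mul_le_mul (hM _) (Lam_diff m) (norm_nonneg _) ((norm_nonneg _).trans (hM 0))

theorem Lam_sum {n : ℕ} (hn : Odd n) {ι : Type*} (s : Finset ι) (a : ι → ℂ) (h : ι → ZMod n → ℂ) :
    Lam (fun x => ∑ i ∈ s, a i * h i x) = ∑ i ∈ s, a i * Lam (h i) := by
  unfold Lam
  simp_rw [← tsum_mul_left]
  rw [← Summable.tsum_finsetSum (fun i _ => (Lam_summable hn (h i)).mul_left (a i))]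
  congr 1
  ext m
  simp_rw [← mul_assoc, ← Finset.sum_mul]
  congr 1
  simp only [cf, Finset.mul_sum]
  rw [Finset.sum_comm]
  refine Finset.sum_congr rfl fun i _ => Finset.sum_congr rfl fun j _ => ?_
  ring

open Filter Topology in
theorem Lam_abel {n : ℕ} [NeZero n] (hn : Odd n) (h : ZMod n → ℂ) :
    Tendsto (fun r : ℝ => ∑' m : ℕ, cf h m * ((r^(m+1)/((m:ℝ)+1) : ℝ) : ℂ)) (𝓝[<] 1) (𝓝 (Lam h)) := by
  obtain ⟨M, hM⟩ := cf_bdd hn h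
  obtain ⟨M', hM'⟩ := cf_bdd' h
  have hev : ∀ᶠ r : ℝ in 𝓝[<] 1, r ∈ Set.Ioo (0:ℝ) 1 := Ioo_mem_nhdsLT (by norm_num)
  refine tendsto_weights (cf h) M 2 hM _ _ _ ?_ ?_ ?_ ?_
  · intro m
    have : Continuous (fun r : ℝ => ((r^(m+1)/((m:ℝ)+1) : ℝ) : ℂ)) := by fun_prop
    have h2 := (this.tendsto 1).mono_left (nhdsWithin_le_nhds (s := Set.Iio 1))
    simpa using h2
  · filter_upwards [hev] with r hr m
    obtain ⟨h0, h1⟩ := hr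
    rw [← Complex.ofReal_sub, Complex.norm_real, Real.norm_eq_abs]
    push_cast
    have e : r^(m+1)/((m:ℝ)+1) - r^(m+1+1)/((m:ℝ)+1+1) =
      (r^(m+1) * (1-r))/((m:ℝ)+1) + r^(m+2) / (((m:ℝ)+1)*((m:ℝ)+2)) := by
      field_simp
      ring
    have hg : r^(m+1) * (1-r) ≤ 1/((m:ℝ)+1) := by
      rw [le_div_iff₀ (by positivity)]
      have g := geom_sum_mul_neg r (m+1)
      have g2 : ((m:ℝ)+1) * r^(m+1) ≤ ∑ i ∈ Finset.range (m+1), r^i := by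
        have := Finset.card_nsmul_le_sum (Finset.range (m+1)) (fun i => r^i) (r^(m+1)) (by
          intro i hi
          exact pow_le_pow_of_le_one h0.le h1.le (Finset.mem_range.1 hi).le)
        simpa [nsmul_eq_mul] using this
      have : 0 < r^(m+1) := by positivity
      nlinarith
    have h3 : 0 ≤ r^(m+1) * (1-r) := mul_nonneg (by positivity) (by linarith)
    rw [e, abs_of_nonneg (by positivity)]
    have i1 : (r^(m+1) * (1-r))/((m:ℝ)+1) ≤ 1/((m:ℝ)+1)^2 := by
      calc _ ≤ (1/((m:ℝ)+1)) / ((m:ℝ)+1) := by gcongr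
        _ = _ := by field_simp
    have i2 : r^(m+2) / (((m:ℝ)+1)*((m:ℝ)+2)) ≤ 1/((m:ℝ)+1)^2 := by
      apply div_le_div₀ (by norm_num) (pow_le_one₀ h0.le h1.le) (by positivity)
      nlinarith [(Nat.cast_nonneg m : (0:ℝ) ≤ m)]
    calc _ ≤ 1/((m:ℝ)+1)^2 + 1/((m:ℝ)+1)^2 := add_le_add i1 i2
      _ = _ := by ring
  · filter_upwards [hev] with r hr
    obtain ⟨h0, h1⟩ := hr
    refine Summable.of_norm_bounded (g := fun m => M' * r^m) ((summable_geometric_of_lt_one h0.le h1).mul_left _) ?_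
    intro m
    rw [norm_mul, Complex.norm_real, Real.norm_eq_abs, abs_of_nonneg (by positivity)]
    refine mul_le_mul (hM' m) ?_ (by positivity) ((norm_nonneg _).trans (hM' 0))
    rw [div_le_iff₀ (by positivity), pow_succ]
    have : 0 < r^m := by positivity
    nlinarith [mul_nonneg this.le (Nat.cast_nonneg m : (0:ℝ) ≤ m)]
  · filter_upwards [hev] with r hr
    obtain ⟨h0, h1⟩ := hr
    refine squeeze_zero_norm (a := fun m => r^m) ?_ (tendsto_pow_atTop_nhds_zero_of_lt_one h0.le h1)
    intro m
    rw [Complex.norm_real, Real.norm_eq_abs, abs_of_nonneg (by positivity)]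
    rw [div_le_iff₀ (by positivity), pow_succ]
    have : 0 < r^m := by positivity
    nlinarith [mul_nonneg this.le (Nat.cast_nonneg m : (0:ℝ) ≤ m)]

open Filter Topology in
theorem Lam_dir {n : ℕ} [NeZero n] (hn : Odd n) (h : ZMod n → ℂ) :
    Tendsto (fun s : ℝ => ∑' m : ℕ, cf h m * ((((m:ℝ)+1)^(-s) : ℝ) : ℂ)) (𝓝[>] 1) (𝓝 (Lam h)) := by
  obtain ⟨M, hM⟩ := cf_bdd hn h
  obtain ⟨M', hM'⟩ := cf_bdd' h
  have hev : ∀ᶠ r : ℝ in 𝓝[>] 1, r ∈ Set.Ioo (1:ℝ) 2 := Ioo_mem_nhdsGT (by norm_num)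
  have hsm : ∀ s : ℝ, 1 < s → Summable (fun m : ℕ => ((m:ℝ)+1)^(-s)) := by
    intro s hs
    have := (summable_nat_add_iff (f := fun m : ℕ => ((m:ℝ))^(-s)) 1).2
      (Real.summable_nat_rpow.2 (by linarith))
    simpa using this
  refine tendsto_weights (cf h) M 2 hM _ _ _ ?_ ?_ ?_ ?_
  · intro m
    have : Continuous (fun s : ℝ => (((((m:ℝ)+1)^(-s) : ℝ)) : ℂ)) := by
      have : (m:ℝ)+1 ≠ 0 := by positivity
      refine Complex.continuous_ofReal.comp ?_
      exact continuous_const.rpow continuous_neg (fun _ => Or.inl this)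
    have h2 := (this.tendsto 1).mono_left (nhdsWithin_le_nhds (s := Set.Ioi 1))
    simpa [Real.rpow_neg_one] using h2
  · filter_upwards [hev] with s hs m
    obtain ⟨h0, h1⟩ := hs
    rw [← Complex.ofReal_sub, Complex.norm_real, Real.norm_eq_abs]
    push_cast
    have hp : (0:ℝ) < (m:ℝ)+1 := by positivity
    have hp2 : (0:ℝ) < (m:ℝ)+1+1 := by positivity
    have e : ((m:ℝ)+1+1)^(-s) = ((m:ℝ)+1)^(-s) * (((m:ℝ)+1)/((m:ℝ)+1+1))^s := by
      rw [Real.div_rpow hp.le hp2.le, Real.rpow_neg hp.le, Real.rpow_neg hp2.le]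
      have := Real.rpow_pos_of_pos hp s
      field_simp
    have hq : (((m:ℝ)+1)/((m:ℝ)+1+1))^2 ≤ (((m:ℝ)+1)/((m:ℝ)+1+1))^s := by
      rw [← Real.rpow_natCast]
      apply Real.rpow_le_rpow_of_exponent_ge (by positivity)
      · rw [div_le_one hp2]; linarith
      · push_cast; exact h1.le
    have hq1 : (((m:ℝ)+1)/((m:ℝ)+1+1))^s ≤ 1 := by
      apply Real.rpow_le_one (by positivity)
      · rw [div_le_one hp2]; linarith
      · linarith
    have hr : ((m:ℝ)+1)^(-s) ≤ 1/((m:ℝ)+1) := by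
      rw [one_div, ← Real.rpow_neg_one]
      apply Real.rpow_le_rpow_of_exponent_le
      · linarith [(Nat.cast_nonneg m : (0:ℝ) ≤ m)]
      · linarith
    have hr0 : 0 < ((m:ℝ)+1)^(-s) := Real.rpow_pos_of_pos hp _
    rw [e, ← mul_one_sub, abs_of_nonneg (mul_nonneg hr0.le (by linarith))]
    have hq2 : 1 - (((m:ℝ)+1)/((m:ℝ)+1+1))^s ≤ 2/((m:ℝ)+1) := by
      have : 1 - (((m:ℝ)+1)/((m:ℝ)+1+1))^2 ≤ 2/((m:ℝ)+1) := by
        have h5 : ((m:ℝ)+1)/((m:ℝ)+1+1) = 1 - 1/((m:ℝ)+1+1) := by field_simp; ring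
        have h6 : 1/((m:ℝ)+1+1) ≤ 1/((m:ℝ)+1) := one_div_le_one_div_of_le hp (by linarith)
        have h7 : 2/((m:ℝ)+1) = 2 * (1/((m:ℝ)+1)) := by ring
        rw [h5, h7]
        nlinarith [sq_nonneg (1/((m:ℝ)+1+1))]
      linarith
    calc _ ≤ (1/((m:ℝ)+1)) * (2/((m:ℝ)+1)) := by
          apply mul_le_mul hr hq2 (by linarith) (by positivity)
      _ = _ := by field_simp
  · filter_upwards [hev] with s hs
    refine Summable.of_norm_bounded ((hsm s hs.1).mul_left M') ?_
    intro m
    have : 0 ≤ ((m:ℝ)+1)^(-s) := Real.rpow_nonneg (by positivity) _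
    rw [norm_mul, Complex.norm_real, Real.norm_eq_abs, abs_of_nonneg this]
    exact mul_le_mul_of_nonneg_right (hM' m) this
  · filter_upwards [hev] with s hs
    have := (hsm s hs.1).tendsto_atTop_zero
    have h2 := (Complex.continuous_ofReal.tendsto 0).comp this
    rw [Complex.ofReal_zero] at h2
    exact h2

theorem one_add_slit {z : ℂ} (hz : ‖z‖ = 1) (h1 : z ≠ -1) : 1 + z ∈ Complex.slitPlane := by
  have h2 : z.re * z.re + z.im * z.im = 1 := by
    have := Complex.normSq_eq_norm_sq z
    rw [hz, Complex.normSq_apply] at this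
    simpa using this
  left
  simp only [Complex.add_re, Complex.one_re]
  by_contra hc
  have h3 : z.re = -1 := by nlinarith [mul_self_nonneg z.im]
  have h4 : z.im = 0 := by
    rw [h3] at h2
    have : z.im * z.im = 0 := by linarith
    exact mul_self_eq_zero.1 this
  exact h1 (Complex.ext (by simp [h3]) (by simp [h4]))

theorem psi_ne {n : ℕ} [NeZero n] (hn : Odd n) (a : ZMod n) : (ZMod.stdAddChar a : ℂ) ≠ -1 := by
  intro h
  have h1 : (ZMod.stdAddChar a : ℂ)^n = 1 := by
    rw [← AddChar.map_nsmul_eq_pow]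
    simp
  rw [h, hn.neg_one_pow] at h1
  norm_num at h1

theorem psi_slit {n : ℕ} [NeZero n] (hn : Odd n) (a : ZMod n) :
    1 + (ZMod.stdAddChar a : ℂ) ∈ Complex.slitPlane :=
  one_add_slit (AddChar.norm_apply _ _) (psi_ne hn a)

open Filter Topology in
theorem Lam_psi {n : ℕ} [NeZero n] (hn : Odd n) (a : ZMod n) :
    Lam (fun x : ZMod n => (ZMod.stdAddChar (a * x) : ℂ)) = Complex.log (1 + ZMod.stdAddChar a) := by
  refine tendsto_nhds_unique (Lam_abel hn _) ?_
  have hev : ∀ᶠ r : ℝ in 𝓝[<] 1, r ∈ Set.Ioo (0:ℝ) 1 := Ioo_mem_nhdsLT (by norm_num)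
  have h1 : Tendsto (fun r : ℝ => Complex.log (1 + r * ZMod.stdAddChar a)) (𝓝[<] 1)
      (𝓝 (Complex.log (1 + ZMod.stdAddChar a))) := by
    have hc : ContinuousAt (fun r : ℝ => Complex.log (1 + r * ZMod.stdAddChar a)) 1 := by
      refine ContinuousAt.clog ?_ ?_
      · fun_prop
      · simpa using psi_slit hn a
    have := hc.tendsto.mono_left (nhdsWithin_le_nhds (s := Set.Iio 1))
    simpa using this
  refine h1.congr' ?_
  filter_upwards [hev] with r hr
  have hz : ‖-((r:ℂ) * ZMod.stdAddChar a)‖ < 1 := by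
    rw [norm_neg, norm_mul, AddChar.norm_apply, Complex.norm_real, Real.norm_eq_abs, abs_of_pos hr.1]
    simpa using hr.2
  have h2 := (Complex.hasSum_taylorSeries_neg_log' hz).neg
  rw [neg_neg, sub_neg_eq_add] at h2
  rw [← h2.tsum_eq]
  congr 1
  ext m
  have h3 : (ZMod.stdAddChar (a * ((m+1:ℕ) : ZMod n)) : ℂ) = (ZMod.stdAddChar a)^(m+1) := by
    rw [← AddChar.map_nsmul_eq_pow]
    simp [mul_comm]
  simp only [cf]
  rw [h3]
  push_cast
  rw [neg_pow, mul_pow, pow_succ (-1 : ℂ)]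
  ring

open Filter Topology in
theorem dir_formula {n : ℕ} [NeZero n] (χ : DirichletCharacter ℂ n) (s : ℝ) (hs : 1 < s) :
    ∑' m : ℕ, cf (fun x => χ x) m * ((((m:ℝ)+1)^(-s) : ℝ) : ℂ) =
      (1 - χ 2 * (2 : ℂ) ^ (1 - (s:ℂ))) * DirichletCharacter.LFunction χ s := by
  have hs' : 1 < (s:ℂ).re := by simpa using hs
  set f : ℕ → ℂ := fun m => χ m * (((m:ℝ)^(-s) : ℝ) : ℂ) with hf
  have hterm : ∀ m, LSeries.term (fun m : ℕ => χ m) s m = f m := by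
    intro m
    rcases Nat.eq_zero_or_pos m with rfl | hm
    · have : (-s) ≠ 0 := by linarith
      simp [hf, Real.zero_rpow this]
    · rw [LSeries.term_of_ne_zero hm.ne', hf]
      simp only
      rw [Complex.ofReal_cpow (by positivity)]
      push_cast
      rw [Complex.cpow_neg, div_eq_mul_inv]
  have hsum : Summable f := by
    have := DirichletCharacter.LSeriesSummable_of_one_lt_re χ hs'
    exact this.congr hterm
  have hL : DirichletCharacter.LFunction χ s = ∑' m, f m := by
    rw [DirichletCharacter.LFunction_eq_LSeries χ hs', LSeries]
    exact tsum_congr hterm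
  have hf0 : f 0 = 0 := by
    have : (-s) ≠ 0 := by linarith
    simp [hf, Real.zero_rpow this]
  have heven : ∀ k, f (2 * k) = (χ 2 * (2:ℂ)^(-(s:ℂ))) * f k := by
    intro k
    simp only [hf]
    push_cast
    rw [Real.mul_rpow (by norm_num) (by positivity), map_mul]
    push_cast
    rw [Complex.ofReal_cpow (by norm_num)]
    push_cast
    ring
  have hi0 : Function.Injective (fun k : ℕ => 2 * k) := fun a b h => by simpa using h
  have hi1 : Function.Injective (fun k : ℕ => 2 * k + 1) := fun a b h => by simpa using h
  have se : Summable (fun k => f (2 * k)) := hsum.comp_injective hi0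
  have so : Summable (fun k => f (2 * k + 1)) := hsum.comp_injective hi1
  have e1 := tsum_even_add_odd se so
  have se' : Summable (fun k => f (2 * (k+1))) := (summable_nat_add_iff 1).2 se
  have e2 : ∑' k, f (2 * (k+1)) = ∑' k, f (2 * k) := by
    rw [se.tsum_eq_zero_add]
    simp [hf0]
  have e3 : ∑' k, f (2*k) = (χ 2 * (2:ℂ)^(-(s:ℂ))) * ∑' k, f k := by
    simp_rw [heven]
    rw [tsum_mul_left]
  have hg : ∀ m, cf (fun x => χ x) m * ((((m:ℝ)+1)^(-s) : ℝ) : ℂ) = (-1)^m * f (m+1) := by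
    intro m
    simp [cf, hf, mul_assoc]
  simp_rw [hg]
  have g0 : ∀ k, (-1:ℂ)^(2*k) * f (2*k+1) = f (2*k+1) := by intro k; simp
  have g1 : ∀ k, (-1:ℂ)^(2*k+1) * f (2*k+1+1) = - f (2*(k+1)) := by
    intro k
    rw [pow_succ, pow_mul]
    simp [mul_add, add_assoc]
  rw [← tsum_even_add_odd (f := fun m => (-1:ℂ)^m * f (m+1))]
  · simp_rw [g0, g1]
    rw [tsum_neg, e2, hL]
    have h2 : (2:ℂ)^(1 - (s:ℂ)) = 2 * (2:ℂ)^(-(s:ℂ)) := by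
      rw [sub_eq_add_neg, Complex.cpow_add _ _ two_ne_zero, Complex.cpow_one]
    rw [h2]
    linear_combination e1 - 2 * e3
  · simp_rw [g0]; exact so
  · simp_rw [g1]; exact se'.neg

open Filter Topology in
theorem tendsto_ofReal_one : Tendsto (fun s : ℝ => (s : ℂ)) (𝓝[>] 1) (𝓝[≠] 1) := by
  refine tendsto_nhdsWithin_iff.2 ⟨?_, ?_⟩
  · have := (Complex.continuous_ofReal.tendsto 1).mono_left (nhdsWithin_le_nhds (s := Set.Ioi 1))
    simpa using this
  · filter_upwards [self_mem_nhdsWithin] with s hs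
    have : (1:ℝ) < s := hs
    simp only [Set.mem_compl_iff, Set.mem_singleton_iff]
    intro h
    have h' : s = 1 := by exact_mod_cast h
    linarith

open Filter Topology in
theorem Lam_chi_ne {n : ℕ} [NeZero n] (hn : Odd n) (χ : DirichletCharacter ℂ n)
    (hχ : χ 2 = 1 → χ = 1) : Lam (fun x => χ x) ≠ 0 := by
  have hev : ∀ᶠ r : ℝ in 𝓝[>] 1, r ∈ Set.Ioo (1:ℝ) 2 := Ioo_mem_nhdsGT (by norm_num)
  have hT := Lam_dir hn (fun x => χ x)
  have hT2 : Tendsto (fun s : ℝ => (1 - χ 2 * (2 : ℂ) ^ (1 - (s:ℂ))) * DirichletCharacter.LFunction χ s)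
      (𝓝[>] 1) (𝓝 (Lam (fun x => χ x))) := by
    refine hT.congr' ?_
    filter_upwards [hev] with s hs
    exact dir_formula χ s hs.1
  by_cases h1 : χ = 1
  · subst h1
    have h2 : (1 : DirichletCharacter ℂ n) 2 = 1 := by
      have : IsUnit (2 : ZMod n) := by
        have := (ZMod.isUnit_iff_coprime 2 n).2 (Nat.coprime_two_left.2 hn)
        simpa using this
      exact MulChar.one_apply this
    have hr := (DirichletCharacter.LFunctionTrivChar_residue_one (N := n)).comp tendsto_ofReal_one
    have hder : HasDerivAt (fun s : ℂ => 1 - (2:ℂ)^(1 - s)) (Complex.log 2) 1 := by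
      have h0 : HasDerivAt (fun s : ℂ => 1 - s) (-1) 1 := by
        simpa using (hasDerivAt_id (1:ℂ)).const_sub 1
      have := (h0.const_cpow (c := 2) (Or.inl two_ne_zero)).const_sub 1
      simpa using this
    have hsl := (hasDerivAt_iff_tendsto_slope.1 hder).comp tendsto_ofReal_one
    have hmul := hsl.mul hr
    have heq : Tendsto (fun s : ℝ => (1 - (1 : DirichletCharacter ℂ n) 2 * (2 : ℂ) ^ (1 - (s:ℂ))) * DirichletCharacter.LFunction (1 : DirichletCharacter ℂ n) s)
      (𝓝[>] 1) (𝓝 (Complex.log 2 * ∏ p ∈ n.primeFactors, (1 - (p : ℂ)⁻¹))) := by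
      refine hmul.congr' ?_
      filter_upwards [hev] with s hs
      have hs1 : (s:ℂ) - 1 ≠ 0 := by
        intro h
        have h' : s = 1 := by exact_mod_cast sub_eq_zero.1 h
        linarith [hs.1]
      simp only [Function.comp, slope_def_field, h2, DirichletCharacter.LFunctionTrivChar]
      simp only [sub_self, Complex.cpow_zero, one_mul, sub_zero]
      field_simp
    rw [tendsto_nhds_unique hT2 heq]
    refine mul_ne_zero ?_ (Finset.prod_ne_zero_iff.2 ?_)
    · rw [show (2:ℂ) = ((2:ℝ):ℂ) by norm_num, ← Complex.ofReal_log (by norm_num)]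
      exact_mod_cast (Real.log_pos (by norm_num)).ne'
    · intro p hp h
      have hp' := (Nat.prime_of_mem_primeFactors hp).one_lt
      have : (p:ℂ) = 1 := by
        have := (sub_eq_zero.1 h).symm
        exact inv_eq_one.1 this
      have : p = 1 := by exact_mod_cast this
      omega
  · have hc : ContinuousAt (fun s : ℂ => (1 - χ 2 * (2 : ℂ) ^ (1 - s)) * DirichletCharacter.LFunction χ s) 1 := by
      refine ContinuousAt.mul ?_ (DirichletCharacter.differentiable_LFunction h1).continuous.continuousAt
      refine continuousAt_const.sub (continuousAt_const.mul ?_)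
      exact ContinuousAt.const_cpow (by fun_prop) (Or.inl two_ne_zero)
    have hlim := (hc.tendsto.mono_left (nhdsWithin_le_nhds (s := {1}ᶜ))).comp tendsto_ofReal_one
    rw [tendsto_nhds_unique hT2 hlim]
    refine mul_ne_zero ?_ (DirichletCharacter.LFunction_apply_one_ne_zero h1)
    simp only [sub_self, Complex.cpow_zero, mul_one]
    intro h
    exact h1 (hχ (sub_eq_zero.1 h).symm)

theorem core_vanish {n : ℕ} [NeZero n] (hn : Odd n)
    (hgen : ∀ χ : DirichletCharacter ℂ n, χ (-1) = 1 → χ 2 = 1 → χ = 1)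
    (G : ZMod n → ℂ) (heven : ∀ x, G (-x) = G x) (hnu : ∀ x, ¬ IsUnit x → G x = 0)
    (hL : ∀ v, Lam (fun m => G (v * m)) = 0) (a : ZMod n) : G a = 0 := by
  have key : ∀ χ : DirichletCharacter ℂ n, ∑ v, χ v * G v = 0 := by
    intro χ
    by_cases hodd : χ (-1) = 1
    · have h1 : ∀ m, ∑ v, χ v * G (v * m) = (∑ v, χ v * G v) * χ⁻¹ m := by
        intro m
        by_cases hm : IsUnit m
        · obtain ⟨u, rfl⟩ := hm
          rw [Finset.sum_mul]
          refine Fintype.sum_equiv (Units.mulRight u) _ _ ?_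
          intro v
          simp only [Units.mulRight_apply, map_mul]
          have : χ u * χ⁻¹ u = 1 := by
            rw [← MulChar.mul_apply, mul_inv_cancel, MulChar.one_apply_coe]
          linear_combination (-(χ v * G (v * u))) * this
        · rw [MulChar.map_nonunit _ hm, mul_zero]
          refine Finset.sum_eq_zero fun v _ => ?_
          rw [hnu _ (fun h => hm (isUnit_of_mul_isUnit_right h)), mul_zero]
      have h2 : Lam (fun m => ∑ v, χ v * G (v * m)) = 0 := by
        rw [Lam_sum hn Finset.univ (fun v => χ v) (fun v m => G (v * m))]
        simp [hL]
      have h3 : Lam (fun m => ∑ v, χ v * G (v * m)) =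
          (∑ v, χ v * G v) * Lam (fun m => χ⁻¹ m) := by
        have := Lam_sum hn {()} (fun _ => ∑ v, χ v * G v) (fun _ m => χ⁻¹ m)
        simp only [Finset.sum_singleton] at this
        rw [← this]
        congr 1
        ext m
        exact h1 m
      rw [h2] at h3
      rcases mul_eq_zero.1 h3.symm with h | h
      · exact h
      · exfalso
        refine Lam_chi_ne hn χ⁻¹ ?_ h
        intro h4
        refine hgen χ⁻¹ ?_ h4
        have : χ (-1) * χ⁻¹ (-1) = 1 := by
          rw [← MulChar.mul_apply, mul_inv_cancel, MulChar.one_apply isUnit_one.neg]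
        rwa [hodd, one_mul] at this
    · have h5 : ∑ v, χ v * G v = χ (-1) * ∑ v, χ v * G v := by
        rw [Finset.mul_sum]
        refine Fintype.sum_equiv (Equiv.neg _) _ _ ?_
        intro v
        rw [Equiv.neg_apply, heven, ← mul_assoc, ← map_mul]
        simp
      have h6 : (1 - χ (-1)) * ∑ v, χ v * G v = 0 := by linear_combination h5
      rcases mul_eq_zero.1 h6 with h | h
      · exact absurd (sub_eq_zero.1 h).symm hodd
      · exact h
  by_cases ha : IsUnit a
  · have h7 : ∑ χ : DirichletCharacter ℂ n, χ a⁻¹ * ∑ v, χ v * G v = 0 :=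
      Finset.sum_eq_zero fun χ _ => by rw [key, mul_zero]
    simp_rw [Finset.mul_sum] at h7
    rw [Finset.sum_comm] at h7
    simp_rw [← mul_assoc, ← Finset.sum_mul, DirichletCharacter.sum_char_inv_mul_char_eq ℂ ha] at h7
    simp only [ite_mul, zero_mul, Finset.sum_ite_eq, Finset.mem_univ, if_true] at h7
    rcases mul_eq_zero.1 h7 with h | h
    · have : n.totient = 0 := by exact_mod_cast h
      rw [Nat.totient_eq_zero] at this
      exact absurd this (NeZero.ne n)
    · exact h
  · exact hnu a ha

theorem gen_of_OFS {n D : ℕ} [NeZero n] (h : OFS n) (hD : D ∣ n)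
    (χ : DirichletCharacter ℂ D) (h1 : χ (-1) = 1) (h2 : χ 2 = 1) : χ = 1 := by
  apply MulChar.ext
  intro u
  rw [MulChar.one_apply_coe]
  obtain ⟨w, rfl⟩ := ZMod.unitsMap_surjective hD u
  have hcop : IsCoprime ((w : ZMod n).val : ℤ) (n : ℤ) :=
    Nat.isCoprime_iff_coprime.2 (ZMod.val_coe_unit_coprime w)
  obtain ⟨j, hj⟩ := h.2.2 _ hcop
  have hw : ((ZMod.unitsMap hD w : (ZMod D)ˣ) : ZMod D) = (((w : ZMod n).val : ℤ) : ZMod D) := by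
    rw [ZMod.unitsMap_val]
    simp [ZMod.natCast_val]
  have hDn : (D : ℤ) ∣ n := by exact_mod_cast hD
  rw [hw]
  rcases hj with hj | hj
  · have := (ZMod.intCast_zmod_eq_zero_iff_dvd _ D).2 (hDn.trans hj)
    push_cast at this ⊢
    rw [sub_eq_zero.1 this, map_pow, h2, one_pow]
  · have := (ZMod.intCast_zmod_eq_zero_iff_dvd _ D).2 (hDn.trans hj)
    push_cast at this ⊢
    rw [eq_neg_of_add_eq_zero_left this, ← neg_one_mul, map_mul, map_pow, h1, h2]
    simp

theorem Lam_congr {n D : ℕ} (f : ZMod n → ℂ) (g : ZMod D → ℂ) (h : ∀ j : ℕ, f j = g j) :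
    Lam f = Lam g := by
  have : cf f = cf g := by
    ext m
    simp only [cf, h]
  simp only [Lam, this]

theorem vanish {n : ℕ} [NeZero n] (h : OFS n) (H : ZMod n → ℂ) (heven : ∀ x, H (-x) = H x)
    (hL : ∀ k, Lam (fun x => H (k * x)) = 0) : ∀ k, H k = 0 := by
  have main : ∀ D : ℕ, ∀ k : ZMod n, addOrderOf k = D → H k = 0 := by
    intro D
    induction D using Nat.strong_induction_on with
    | _ D ih =>
      intro k hk
      have hDn : D ∣ n := by
        rw [← hk]
        have := addOrderOf_dvd_natCard k
        simpa using this
      have hn := h.1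
      have hDodd : Odd D := Odd.of_dvd_nat hn hDn
      have : NeZero D := ⟨hDodd.pos.ne'⟩
      let φ : ZMod D →+ ZMod n := ZMod.lift D ⟨zmultiplesHom _ k, by
        simp only [zmultiplesHom_apply, natCast_zsmul]
        rw [← hk]
        exact addOrderOf_nsmul_eq_zero k⟩
      have hφ1 : φ 1 = k := by
        have := ZMod.lift_coe D ⟨zmultiplesHom _ k, by
          simp only [zmultiplesHom_apply, natCast_zsmul]
          rw [← hk]
          exact addOrderOf_nsmul_eq_zero k⟩ 1
        simpa using this
      have hφ : ∀ (v : ZMod D) (j : ℕ), φ (v * j) = φ v * j := by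
        intro v j
        rw [mul_comm, ← nsmul_eq_mul, map_nsmul, nsmul_eq_mul, mul_comm]
      rw [← hφ1]
      refine core_vanish hDodd (gen_of_OFS h hDn) (fun x => H (φ x)) ?_ ?_ ?_ 1
      · intro x
        simp only [map_neg, heven]
      · intro x hx
        have hxv : ¬ Nat.Coprime x.val D := by
          intro hc
          apply hx
          rw [← ZMod.natCast_zmod_val x]
          exact (ZMod.isUnit_iff_coprime _ _).2 hc
        have hg : 1 < Nat.gcd x.val D := by
          have : 0 < Nat.gcd x.val D := Nat.gcd_pos_of_pos_right _ hDodd.pos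
          have h2 : Nat.gcd x.val D ≠ 1 := hxv
          omega
        have hz : (D / Nat.gcd x.val D) • φ x = 0 := by
          rw [← map_nsmul]
          have : (D / Nat.gcd x.val D) • x = 0 := by
            obtain ⟨q, hq⟩ := Nat.gcd_dvd_left x.val D
            have hd := Nat.div_mul_cancel (Nat.gcd_dvd_right x.val D)
            rw [← ZMod.natCast_zmod_val x, nsmul_eq_mul, ← Nat.cast_mul, ZMod.natCast_eq_zero_iff,
              ZMod.natCast_zmod_val]
            refine ⟨q, ?_⟩
            calc D / Nat.gcd x.val D * x.val = D / Nat.gcd x.val D * (Nat.gcd x.val D * q) :=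
                  congrArg _ hq
              _ = D * q := by rw [← mul_assoc, hd]
          rw [this, map_zero]
        have hpos : 0 < D / Nat.gcd x.val D :=
          Nat.div_pos (Nat.gcd_le_right _ hDodd.pos) (by omega)
        have hlt : addOrderOf (φ x) < D :=
          lt_of_le_of_lt (addOrderOf_le_of_nsmul_eq_zero hpos hz) (Nat.div_lt_self hDodd.pos hg)
        exact ih _ hlt _ rfl
      · intro v
        rw [← hL (φ v)]
        apply Lam_congr
        intro j
        rw [hφ]
  exact fun k => main _ k rfl

theorem FS_cons {G : Type*} [AddCommGroup G] (a : G) (A : Multiset G) :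
    FS (a ::ₘ A) = FS A + (FS A).map (fun x => a + x) := by
  simp [FS, Multiset.powerset_cons, Multiset.map_map, Function.comp_def]

theorem FS_neg_add {G : Type*} [AddCommGroup G] (B C : Multiset G) :
    FS (C + B.map (fun x => -x)) = (FS (C + B)).map (fun x => x - B.sum) := by
  induction B using Multiset.induction_on generalizing C with
  | empty => simp
  | cons a B ih =>
    rw [Multiset.map_cons, Multiset.add_cons, FS_cons, ih, Multiset.add_cons, FS_cons, add_comm]
    simp only [Multiset.map_add, Multiset.map_map, Function.comp_def, Multiset.sum_cons]
    congr 1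
    · refine Multiset.map_congr rfl fun x _ => ?_
      abel
    · refine Multiset.map_congr rfl fun x _ => ?_
      abel

theorem FS_of_sim {G : Type*} [AddCommGroup G] [DecidableEq G] (A A' : Multiset G)
    (h : Sim0 A A') : FS A = FS A' := by
  obtain ⟨B, hB, h0, rfl⟩ := h
  rw [FS_neg_add, h0, tsub_add_cancel_of_le hB]
  simp

theorem FS_char {G : Type*} [AddCommGroup G] (ψ : AddChar G ℂ) (A : Multiset G) :
    ((FS A).map (fun x => ψ x)).sum = (A.map (fun a => 1 + ψ a)).prod := by
  induction A using Multiset.induction_on with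
  | empty => simp [FS]
  | cons a A ih =>
    rw [FS_cons, Multiset.map_add, Multiset.sum_add, Multiset.map_map, Multiset.map_cons,
      Multiset.prod_cons, ih]
    simp only [Function.comp_def, AddChar.map_add_eq_mul, Multiset.sum_map_mul_left, ih]
    ring

theorem log_prod {n : ℕ} [NeZero n] (hn : Odd n) (A : Multiset (ZMod n)) (k : ZMod n) :
    Real.log ‖(A.map (fun a => 1 + (ZMod.stdAddChar (k * a) : ℂ))).prod‖ =
      ∑ a, (A.count a : ℝ) * Real.log ‖1 + (ZMod.stdAddChar (k * a) : ℂ)‖ := by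
  induction A using Multiset.induction_on with
  | empty => simp
  | cons b A ih =>
    rw [Multiset.map_cons, Multiset.prod_cons, norm_mul, Real.log_mul, ih]
    · simp only [Multiset.count_cons, Nat.cast_add, add_mul, Finset.sum_add_distrib]
      rw [add_comm]
      congr 1
      simp
    · exact norm_ne_zero_iff.2 (Complex.slitPlane_ne_zero (psi_slit hn _))
    · refine norm_ne_zero_iff.2 (Multiset.prod_ne_zero ?_)
      intro h
      obtain ⟨a, _, ha⟩ := Multiset.mem_map.1 h
      exact Complex.slitPlane_ne_zero (psi_slit hn _) ha

theorem Lam_even {n : ℕ} [NeZero n] (hn : Odd n) (b : ZMod n) :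
    Lam (fun x : ZMod n => (ZMod.stdAddChar (b * x) + ZMod.stdAddChar (-b * x) : ℂ)) =
      2 * (Real.log ‖1 + (ZMod.stdAddChar b : ℂ)‖ : ℂ) := by
  have h := Lam_sum hn (Finset.univ : Finset Bool) (fun _ => 1)
    (fun i x => (ZMod.stdAddChar ((if i then b else -b) * x) : ℂ))
  simp only [one_mul, Fintype.sum_bool, if_true, Bool.false_eq_true, if_false] at h
  rw [h, Lam_psi hn, Lam_psi hn]
  have hc : 1 + (ZMod.stdAddChar (-b) : ℂ) = (starRingEnd ℂ) (1 + ZMod.stdAddChar b) := by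
    rw [map_add, map_one, AddChar.map_neg_eq_conj]
  rw [hc, Complex.log_conj _ (Complex.mem_slitPlane_iff_arg.1 (psi_slit hn b)).1, Complex.add_conj,
    Complex.log_re]
  push_cast
  ring

theorem counts {n : ℕ} [NeZero n] (h : OFS n) (A A' : Multiset (ZMod n)) (hFS : FS A = FS A')
    (x : ZMod n) : A.count x + A.count (-x) = A'.count x + A'.count (-x) := by
  have hn := h.1
  set d : ZMod n → ℂ := fun a => (A.count a : ℂ) - A'.count a with hd
  set H : ZMod n → ℂ := fun y => ∑ a, d a * (ZMod.stdAddChar (a * y) + ZMod.stdAddChar (-a * y) : ℂ) with hH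
  have hprod : ∀ k : ZMod n, (A.map (fun a => 1 + (ZMod.stdAddChar (k * a) : ℂ))).prod =
      (A'.map (fun a => 1 + (ZMod.stdAddChar (k * a) : ℂ))).prod := by
    intro k
    have h1 := FS_char (ZMod.stdAddChar.mulShift k) A
    have h2 := FS_char (ZMod.stdAddChar.mulShift k) A'
    rw [hFS, h2] at h1
    simpa [AddChar.mulShift_apply] using h1.symm
  have hvan : ∀ k, H k = 0 := by
    refine vanish h H ?_ ?_
    · intro y
      simp only [hH]
      refine Finset.sum_congr rfl fun a _ => ?_
      rw [mul_neg, neg_mul, neg_mul, mul_neg, neg_neg, add_comm]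
    · intro k
      have e1 : (fun y => H (k * y)) = fun y => ∑ a, d a *
          (ZMod.stdAddChar ((k * a) * y) + ZMod.stdAddChar (-(k * a) * y) : ℂ) := by
        ext y
        simp only [hH]
        refine Finset.sum_congr rfl fun a _ => ?_
        congr 3 <;> ring_nf
      rw [e1, Lam_sum hn Finset.univ d
        (fun a y => (ZMod.stdAddChar ((k * a) * y) + ZMod.stdAddChar (-(k * a) * y) : ℂ))]
      simp_rw [Lam_even hn]
      have l1 := log_prod hn A k
      have l2 := log_prod hn A' k
      rw [hprod k, l2] at l1
      have l3 := congrArg (fun t : ℝ => (t : ℂ)) l1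
      push_cast at l3
      have : ∑ a, d a * (2 * (Real.log ‖1 + (ZMod.stdAddChar (k * a) : ℂ)‖ : ℂ)) =
        2 * (∑ a, (A.count a : ℂ) * (Real.log ‖1 + (ZMod.stdAddChar (k * a) : ℂ)‖ : ℂ)
          - ∑ a, (A'.count a : ℂ) * (Real.log ‖1 + (ZMod.stdAddChar (k * a) : ℂ)‖ : ℂ)) := by
        rw [← Finset.sum_sub_distrib, Finset.mul_sum]
        refine Finset.sum_congr rfl fun a _ => ?_
        simp only [hd]
        ring
      rw [this, l3, sub_self, mul_zero]
  have h0 : ∑ k, (ZMod.stdAddChar (k * (-x)) : ℂ) * H k = 0 :=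
    Finset.sum_eq_zero fun k _ => by rw [hvan, mul_zero]
  have h1 : ∑ k, (ZMod.stdAddChar (k * (-x)) : ℂ) * H k =
      ∑ a, d a * (∑ k, (ZMod.stdAddChar (k * (a - x)) : ℂ) + ∑ k, (ZMod.stdAddChar (k * (-a - x)) : ℂ)) := by
    simp only [hH, Finset.mul_sum, ← Finset.sum_add_distrib]
    rw [Finset.sum_comm]
    refine Finset.sum_congr rfl fun a _ => Finset.sum_congr rfl fun k _ => ?_
    have e1 : k * (a - x) = k * (-x) + a * k := by ring
    have e2 : k * (-a - x) = k * (-x) + -a * k := by ring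
    rw [e1, e2, AddChar.map_add_eq_mul, AddChar.map_add_eq_mul]
    ring
  rw [h1] at h0
  simp_rw [AddChar.sum_mulShift _ (ZMod.isPrimitive_stdAddChar n)] at h0
  have e2 : ∀ a : ZMod n, (-a = x) ↔ a = -x := fun a => neg_eq_iff_eq_neg
  simp only [sub_eq_zero, e2, mul_add, Finset.sum_add_distrib, Nat.cast_ite, mul_ite, Nat.cast_zero, mul_zero, Finset.sum_ite_eq',
    Finset.mem_univ, if_true, ZMod.card] at h0
  rw [← add_mul] at h0
  have hn0 : (n:ℂ) ≠ 0 := by exact_mod_cast NeZero.ne n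
  have h3 := (mul_eq_zero.1 h0).resolve_right hn0
  simp only [hd] at h3
  have h4 : (A.count x + A.count (-x) : ℂ) = A'.count x + A'.count (-x) := by
    linear_combination h3
  exact_mod_cast h4

/-- If `n ∈ O_FS` then `ℤ/nℤ` is `FS`-regular. -/
theorem FSRegular_of_OFS (n : ℕ) (h : OFS n) :
    ∀ A A' : Multiset (ZMod n), FS A = FS A' ↔ Sim0 A A' := by
  intro A A'
  have : NeZero n := ⟨h.1.pos.ne'⟩
  refine ⟨fun hFS => ?_, FS_of_sim A A'⟩
  have hc := counts h A A' hFS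
  have hA' : A' = (A - (A - A')) + (A - A').map (fun x => -x) := by
    ext x
    have hm : Multiset.count x ((A - A').map (fun x => -x)) = Multiset.count (-x) (A - A') := by
      have := Multiset.count_map_eq_count' (fun x : ZMod n => -x) (A - A') neg_injective (-x)
      rwa [neg_neg] at this
    rw [Multiset.count_add, hm, Multiset.count_sub, Multiset.count_sub, Multiset.count_sub]
    have := hc x
    omega
  refine ⟨A - A', Multiset.sub_le_self _ _, ?_, hA'⟩
  have hA : A - (A - A') + (A - A') = A := tsub_add_cancel_of_le (Multiset.sub_le_self _ _)
  have h1 := FS_neg_add (A - A') (A - (A - A'))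
  rw [← hA', hA, ← hFS] at h1
  have h2 := congrArg (fun S => (Multiset.map (fun x => (ZMod.stdAddChar x : ℂ)) S).sum) h1
  simp only [Multiset.map_map, Function.comp_def, sub_eq_add_neg, AddChar.map_add_eq_mul,
    Multiset.sum_map_mul_right] at h2
  rw [FS_char] at h2
  have hne : (A.map (fun a => 1 + (ZMod.stdAddChar a : ℂ))).prod ≠ 0 := by
    refine Multiset.prod_ne_zero ?_
    intro h'
    obtain ⟨a, _, ha⟩ := Multiset.mem_map.1 h'
    exact Complex.slitPlane_ne_zero (psi_slit h.1 _) ha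
  have h3 : (ZMod.stdAddChar (-(A - A').sum) : ℂ) = ZMod.stdAddChar (0 : ZMod n) := by
    rw [AddChar.map_zero_eq_one]
    refine mul_left_cancel₀ hne ?_
    rw [mul_one]
    exact h2.symm
  exact neg_eq_zero.1 (ZMod.injective_stdAddChar h3)
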